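/- For every complex number w with Re w < 1 and every real t > 0, the limit defining φ_{w,0}(t) exists; for each fixed t > 0 the function w ↦ φ_{w,0}(t) is holomorphic on the half-plane Re w < 1; for every compact subset Ω of {w : Re w < 1} there is a constant C with |φ_{w,0}(t)| ≤ C/t for all w ∈ Ω and all t ≥ 1; and there is a constant C' such that |φ_{w,0}(t) − U(w)·t^{−w}| ≤ C' for all w with 0 < Re w < 1 and all 0 < t ≤ 1. -/

import Mathlib

open MeasureTheory Set Filter intervalIntegral

/-- The Báez-Duarte spectral function
`U(w) = (w/(1-w))·2^{1-w}·π^{-w}·cos(πw/2)·Γ(w)`. -/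
noncomputable def baezDuarteU (w : ℂ) : ℂ :=
  (w / (1 - w)) * (2 : ℂ) ^ (1 - w) * (Real.pi : ℂ) ^ (-w)
    * Complex.cos ((Real.pi : ℂ) * w / 2) * Complex.Gamma w

namespace Complex

/-- The integrand of Euler's integral at a complex rate with positive real part. -/
lemma integrableOn_cpow_mul_exp_neg_mul_Ioi {a r : ℂ} (ha : 0 < a.re) (hr : 0 < r.re) :
    IntegrableOn (fun x : ℝ => (x : ℂ) ^ (a - 1) * exp (-(r * x))) (Ioi 0) := by
  have h := integrableOn_rpow_mul_exp_neg_mul_rpow (p := 1) (s := a.re - 1) (b := r.re)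
    (by linarith) one_pos hr
  refine h.mono' (ContinuousOn.aestronglyMeasurable ?_ measurableSet_Ioi) ?_
  · intro x hx
    refine (ContinuousAt.mul ?_ (by fun_prop)).continuousWithinAt
    exact continuousAt_ofReal_cpow_const x _ (Or.inr (ne_of_gt hx))
  · refine (ae_restrict_iff' measurableSet_Ioi).2 (Eventually.of_forall fun x hx => ?_)
    rw [norm_mul, norm_cpow_eq_rpow_re_of_pos hx, norm_exp]
    simp

/-- Euler's integral with a complex rate is holomorphic in the rate. -/
lemma differentiableOn_integral_cpow_mul_exp_neg_mul {a : ℂ} (ha : 0 < a.re) :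
    DifferentiableOn ℂ (fun r : ℂ => ∫ x : ℝ in Ioi 0, (x : ℂ) ^ (a - 1) * exp (-(r * x)))
      {r : ℂ | 0 < r.re} := by
  intro r hr
  have hr : 0 < r.re := hr
  have hs : {z : ℂ | r.re / 2 < z.re} ∈ nhds r :=
    (isOpen_lt continuous_const continuous_re).mem_nhds (by simp; linarith)
  have hmeas : ∀ z : ℂ, 0 < z.re → AEStronglyMeasurable
      (fun x : ℝ => (x : ℂ) ^ (a - 1) * exp (-(z * x))) (volume.restrict (Ioi 0)) :=
    fun z hz => (integrableOn_cpow_mul_exp_neg_mul_Ioi ha hz).aestronglyMeasurable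
  have hbound := integrableOn_rpow_mul_exp_neg_mul_rpow (p := 1) (s := a.re) (b := r.re / 2)
    (by linarith) one_pos (by linarith)
  refine (_root_.hasDerivAt_integral_of_dominated_loc_of_deriv_le (μ := volume.restrict (Ioi 0))
    (F := fun z (x : ℝ) => (x : ℂ) ^ (a - 1) * exp (-(z * x)))
    (F' := fun z (x : ℝ) => (x : ℂ) ^ (a - 1) * (exp (-(z * x)) * -(x : ℂ)))
    hs ?_ (integrableOn_cpow_mul_exp_neg_mul_Ioi ha hr) ?_ ?_ hbound
    ?_).2.differentiableAt.differentiableWithinAt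
  · filter_upwards [hs] with z hz
    exact hmeas z (by linarith [show r.re / 2 < z.re from hz])
  · have := (hmeas r hr).mul
      (Complex.measurable_ofReal.neg.aestronglyMeasurable (μ := volume.restrict (Ioi 0)))
    refine this.congr (Eventually.of_forall fun x => ?_)
    simp [mul_assoc]
  · refine (ae_restrict_iff' measurableSet_Ioi).2 (Eventually.of_forall fun x hx z hz => ?_)
    have hx : 0 < x := hx
    have hz : r.re / 2 < z.re := hz
    rw [norm_mul, norm_mul, norm_cpow_eq_rpow_re_of_pos hx, norm_exp, norm_neg, norm_real,
      Real.norm_of_nonneg hx.le, sub_re, one_re, Real.rpow_sub_one hx.ne', Real.rpow_one,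
      div_mul_eq_mul_div, mul_div_assoc, mul_div_cancel_right₀ _ hx.ne']
    gcongr
    simp
    nlinarith
  · refine Eventually.of_forall fun x z _ => ?_
    refine HasDerivAt.const_mul _ (HasDerivAt.cexp ?_)
    simpa using! ((hasDerivAt_id z).mul_const (x : ℂ)).neg

/-- Euler's integral with a complex rate of positive real part. -/
lemma integral_cpow_mul_exp_neg_complex_mul_Ioi {a r : ℂ} (ha : 0 < a.re) (hr : 0 < r.re) :
    ∫ x : ℝ in Ioi 0, (x : ℂ) ^ (a - 1) * exp (-(r * x)) = (1 / r) ^ a * Gamma a := by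
  have hU : IsOpen {r : ℂ | 0 < r.re} := isOpen_lt continuous_const continuous_re
  have hR : DifferentiableOn ℂ (fun r : ℂ => (1 / r) ^ a * Gamma a) {r : ℂ | 0 < r.re} := by
    intro z hz
    have hz : 0 < z.re := hz
    have hz0 : z ≠ 0 := fun h => by simp [h] at hz
    refine DifferentiableAt.differentiableWithinAt ?_
    refine DifferentiableAt.mul_const (DifferentiableAt.cpow ?_ (by fun_prop) ?_) _
    · exact (differentiableAt_const _).div differentiableAt_id hz0
    · left
      rw [one_div, inv_re]
      exact div_pos hz (normSq_pos.2 hz0)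
  refine ((differentiableOn_integral_cpow_mul_exp_neg_mul ha).analyticOnNhd
    hU).eqOn_of_preconnected_of_frequently_eq (hR.analyticOnNhd hU)
    (convex_halfSpace_re_gt 0).isPreconnected (z₀ := 1) (by simp) ?_ hr
  have hlim : Tendsto (fun n : ℕ => ((1 + 1 / ((n : ℝ) + 1) : ℝ) : ℂ)) atTop
      (nhdsWithin 1 {1}ᶜ) := by
    refine tendsto_nhdsWithin_iff.2 ⟨?_, Eventually.of_forall fun n => ?_⟩
    · have := (tendsto_one_div_add_atTop_nhds_zero_nat (𝕜 := ℝ)).const_add 1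
      simpa [Function.comp_def] using (continuous_ofReal.tendsto _).comp this
    · have : (0 : ℝ) < 1 / ((n : ℝ) + 1) := by positivity
      simp only [mem_compl_iff, mem_singleton_iff, ofReal_eq_one]
      linarith
  refine hlim.frequently (Eventually.frequently (Eventually.of_forall fun n => ?_))
  exact integral_cpow_mul_exp_neg_mul_Ioi ha (by positivity)

end Complex

lemma norm_exp_neg_mul_sin_le {ε x : ℝ} (hε : 0 ≤ ε) (hx : 0 ≤ x) :
    ‖Complex.exp (-(ε * x)) * Complex.sin x‖ ≤ ‖Complex.sin x‖ := by
  rw [norm_mul, Complex.norm_exp]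
  refine mul_le_of_le_one_left (norm_nonneg _) (Real.exp_le_one_iff.2 ?_)
  simpa using mul_nonneg hε hx

lemma mellinConvergent_sin {s : ℂ} (h₁ : -1 < s.re) (h₂ : s.re < 0) :
    MellinConvergent (fun x : ℝ => Complex.sin x) s := by
  refine mellinConvergent_of_isBigO_rpow (a := 0) (b := -1) ?_ ?_ h₂ ?_ h₁
  · exact (by fun_prop : Continuous fun x : ℝ => Complex.sin x).continuousOn.locallyIntegrableOn
      measurableSet_Ioi
  · refine Asymptotics.IsBigO.of_bound 1 (Eventually.of_forall fun x => ?_)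
    simpa [← Complex.ofReal_sin] using Real.abs_sin_le_one x
  · refine Asymptotics.IsBigO.of_bound 1 (Eventually.of_forall fun x => ?_)
    simpa [← Complex.ofReal_sin] using Real.abs_sin_le_abs

/-- Abel-regularised Mellin transform of the sine. -/
lemma mellin_exp_neg_mul_sin {s : ℂ} (h₁ : -1 < s.re) (h₂ : s.re < 0) {ε : ℝ} (hε : 0 < ε) :
    mellin (fun x : ℝ => Complex.exp (-(ε * x)) * Complex.sin x) s =
      -(Complex.Gamma (s + 1) / s) *
        ((ε + Complex.I) * (1 / (ε + Complex.I)) ^ (s + 1)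
          - (ε - Complex.I) * (1 / (ε - Complex.I)) ^ (s + 1)) / (2 * Complex.I) := by
  have hs0 : s ≠ 0 := fun h => by simp [h] at h₂
  have hs1 : 0 < (s + 1).re := by simp; linarith
  have hconv : IntegrableOn (fun x : ℝ => (x : ℂ) ^ (s - 1) *
      (Complex.exp (-(ε * x)) * Complex.sin x)) (Ioi 0) := by
    refine (mellinConvergent_sin h₁ h₂).norm.mono' ?_ ?_
    · refine ContinuousOn.aestronglyMeasurable (fun x hx => ?_) measurableSet_Ioi
      refine (ContinuousAt.mul ?_ (by fun_prop)).continuousWithinAt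
      exact Complex.continuousAt_ofReal_cpow_const x _ (Or.inr (ne_of_gt hx))
    · refine (ae_restrict_iff' measurableSet_Ioi).2 (Eventually.of_forall fun x hx => ?_)
      rw [smul_eq_mul, norm_mul, norm_mul ((x : ℂ) ^ (s - 1))]
      refine mul_le_mul_of_nonneg_left ?_ (norm_nonneg _)
      exact norm_exp_neg_mul_sin_le hε.le (le_of_lt hx)
  have hp : 0 < ((ε : ℂ) + Complex.I).re := by simpa
  have hm : 0 < ((ε : ℂ) - Complex.I).re := by simpa
  have ip := Complex.integrableOn_cpow_mul_exp_neg_mul_Ioi hs1 hp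
  have im := Complex.integrableOn_cpow_mul_exp_neg_mul_Ioi hs1 hm
  have vp := Complex.integral_cpow_mul_exp_neg_complex_mul_Ioi hs1 hp
  have vm := Complex.integral_cpow_mul_exp_neg_complex_mul_Ioi hs1 hm
  rw [add_sub_cancel_right] at ip im vp vm
  have hsin : ∀ x : ℝ, Complex.exp (-(ε * x)) * Complex.sin x =
      (Complex.exp (-((ε - Complex.I) * x)) - Complex.exp (-((ε + Complex.I) * x)))
        / (2 * Complex.I) := by
    intro x
    have hm' : -((ε - Complex.I) * x) = -(ε * x) + x * Complex.I := by ring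
    have hp' : -((ε + Complex.I) * x) = -(ε * x) + -x * Complex.I := by ring
    rw [hm', hp', Complex.exp_add, Complex.exp_add, eq_div_iff (by simp), Complex.sin]
    linear_combination -(Complex.exp (-(ε * x)) *
      (Complex.exp (x * Complex.I) - Complex.exp (-x * Complex.I))) * Complex.I_sq
  have hderiv : ∀ x : ℝ, HasDerivAt (fun x : ℝ => Complex.exp (-(ε * x)) * Complex.sin x)
      (((ε + Complex.I) * Complex.exp (-((ε + Complex.I) * x))
        - (ε - Complex.I) * Complex.exp (-((ε - Complex.I) * x))) / (2 * Complex.I)) x := by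
    intro x
    simp_rw [hsin]
    have h : ∀ r : ℂ, HasDerivAt (fun x : ℝ => Complex.exp (-(r * x)))
        (Complex.exp (-(r * x)) * -(r * 1)) x := fun r =>
      ((Complex.ofRealCLM.hasDerivAt (x := x)).const_mul r).neg.cexp
    refine (((h (ε - Complex.I)).sub (h (ε + Complex.I))).div_const (2 * Complex.I)).congr_deriv ?_
    ring
  have hint : IntegrableOn (fun x : ℝ => (x : ℂ) ^ s / s *
      (((ε + Complex.I) * Complex.exp (-((ε + Complex.I) * x))
        - (ε - Complex.I) * Complex.exp (-((ε - Complex.I) * x))) / (2 * Complex.I))) (Ioi 0) := by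
    refine (((ip.const_mul (ε + Complex.I)).sub (im.const_mul (ε - Complex.I))).const_mul
      (1 / s / (2 * Complex.I))).congr (Eventually.of_forall fun x => ?_)
    simp only [Pi.sub_apply]
    ring
  have hnorm : ∀ x : ℝ, 0 < x → ‖(x : ℂ) ^ s / s * (Complex.exp (-(ε * x)) * Complex.sin x)‖
      ≤ x ^ s.re / ‖s‖ * ‖Complex.sin x‖ := fun x hx => by
    rw [norm_mul, norm_div, Complex.norm_cpow_eq_rpow_re_of_pos hx]
    gcongr
    exact norm_exp_neg_mul_sin_le hε.le hx.le
  have hzero : Tendsto ((fun x : ℝ => (x : ℂ) ^ s / s) *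
      fun x : ℝ => Complex.exp (-(ε * x)) * Complex.sin x) (nhdsWithin 0 (Ioi 0)) (nhds 0) := by
    have : Tendsto (fun x : ℝ => x ^ (s.re + 1) / ‖s‖) (nhdsWithin 0 (Ioi 0)) (nhds 0) := by
      have := (Real.continuousAt_rpow_const 0 (s.re + 1)
        (Or.inr (by linarith))).tendsto.div_const ‖s‖
      rw [Real.zero_rpow (by linarith), zero_div] at this
      exact this.mono_left nhdsWithin_le_nhds
    refine squeeze_zero_norm' ?_ this
    filter_upwards [self_mem_nhdsWithin] with x hx
    have hx : 0 < x := hx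
    refine (hnorm x hx).trans ?_
    rw [Real.rpow_add_one hx.ne', mul_div_right_comm]
    gcongr
    simpa [← Complex.ofReal_sin, abs_of_pos hx] using Real.abs_sin_le_abs (x := x)
  have htop : Tendsto ((fun x : ℝ => (x : ℂ) ^ s / s) *
      fun x : ℝ => Complex.exp (-(ε * x)) * Complex.sin x) atTop (nhds 0) := by
    have : Tendsto (fun x : ℝ => x ^ s.re / ‖s‖) atTop (nhds 0) := by
      have := (tendsto_rpow_neg_atTop (y := -s.re) (by linarith)).div_const ‖s‖
      simpa using this
    refine squeeze_zero_norm' ?_ this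
    filter_upwards [eventually_gt_atTop 0] with x hx
    refine (hnorm x hx).trans (mul_le_of_le_one_right (by positivity) ?_)
    simpa [← Complex.ofReal_sin] using Real.abs_sin_le_one x
  have key := integral_Ioi_mul_deriv_eq_deriv_mul
    (u' := fun x : ℝ => (x : ℂ) ^ (s - 1)) (fun x hx => ?_) (fun x _ => hderiv x) hint hconv
    hzero htop
  · rw [sub_zero, zero_sub, eq_neg_iff_add_eq_zero] at key
    simp only [mellin, smul_eq_mul]
    rw [eq_neg_of_add_eq_zero_right key]
    have : ∀ x : ℝ, (x : ℂ) ^ s / s *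
      (((ε + Complex.I) * Complex.exp (-((ε + Complex.I) * x))
        - (ε - Complex.I) * Complex.exp (-((ε - Complex.I) * x))) / (2 * Complex.I)) =
      (1 / s / (2 * Complex.I)) *
        ((ε + Complex.I) * ((x : ℂ) ^ s * Complex.exp (-((ε + Complex.I) * x)))
        - (ε - Complex.I) * ((x : ℂ) ^ s * Complex.exp (-((ε - Complex.I) * x)))) := fun x => by ring
    simp_rw [this]
    rw [MeasureTheory.integral_const_mul,
      MeasureTheory.integral_sub (ip.const_mul _) (im.const_mul _),
      MeasureTheory.integral_const_mul, MeasureTheory.integral_const_mul, vp, vm]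
    ring
  · have hx : 0 < x := hx
    convert (hasDerivAt_ofReal_cpow_const hx.ne' hs0).div_const s using 1
    field_simp

/-- The Mellin transform of the sine in the strip of absolute convergence `-1 < Re s < 0`. -/
lemma mellin_sin {s : ℂ} (h₁ : -1 < s.re) (h₂ : s.re < 0) :
    mellin (fun x : ℝ => Complex.sin x) s =
      -(Complex.Gamma (s + 1) / s) * Complex.cos (Real.pi * (s + 1) / 2) := by
  have hL : Tendsto (fun ε : ℝ => mellin (fun x : ℝ => Complex.exp (-(ε * x)) * Complex.sin x) s)
      (nhdsWithin 0 (Ioi 0)) (nhds (mellin (fun x : ℝ => Complex.sin x) s)) := by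
    refine MeasureTheory.tendsto_integral_filter_of_dominated_convergence _ ?_ ?_
      (mellinConvergent_sin h₁ h₂).norm ?_
    · refine Eventually.of_forall fun ε => ?_
      refine ContinuousOn.aestronglyMeasurable (fun x hx => ?_) measurableSet_Ioi
      refine (ContinuousAt.mul ?_ (by fun_prop)).continuousWithinAt
      exact Complex.continuousAt_ofReal_cpow_const x _ (Or.inr (ne_of_gt hx))
    · filter_upwards [self_mem_nhdsWithin] with ε hε
      refine (ae_restrict_iff' measurableSet_Ioi).2 (Eventually.of_forall fun x hx => ?_)
      rw [norm_smul, norm_smul]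
      refine mul_le_mul_of_nonneg_left ?_ (norm_nonneg _)
      exact norm_exp_neg_mul_sin_le (le_of_lt hε) (le_of_lt hx)
    · refine Eventually.of_forall fun x => Tendsto.mono_left ?_ nhdsWithin_le_nhds
      have : Continuous fun ε : ℝ => (x : ℂ) ^ (s - 1) • (Complex.exp (-(ε * x)) * Complex.sin x) := by
        fun_prop
      simpa using this.tendsto 0
  have hc : ∀ z : ℂ, z.re = 0 → z.im ≠ 0 →
      ContinuousAt (fun ε : ℝ => ((ε : ℂ) + z) * (1 / ((ε : ℂ) + z)) ^ (s + 1)) 0 := by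
    intro z hz hz'
    have hz0 : z ≠ 0 := fun h => by simp [h] at hz'
    refine ContinuousAt.mul (by fun_prop) (ContinuousAt.cpow ?_ (by fun_prop) ?_)
    · exact ContinuousAt.div (by fun_prop) (by fun_prop) (by simpa)
    · right
      simp [Complex.inv_im, hz', hz0]
  have hR := ((((hc Complex.I (by simp) (by simp)).sub
    (hc (-Complex.I) (by simp) (by simp))).const_mul (-(Complex.Gamma (s + 1) / s))).div_const
      (2 * Complex.I)).tendsto.mono_left (nhdsWithin_le_nhds (s := Ioi 0))
  rw [tendsto_nhds_unique (hL.congr' ?_) hR]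
  · have hI : (1 / Complex.I) ^ (s + 1) = Complex.exp (-(Real.pi * (s + 1) / 2 * Complex.I)) := by
      rw [one_div, Complex.inv_I, Complex.cpow_def_of_ne_zero (by simp), Complex.log_neg_I]
      congr 1; ring
    have hI' : (1 / -Complex.I) ^ (s + 1) = Complex.exp (Real.pi * (s + 1) / 2 * Complex.I) := by
      rw [one_div, inv_neg, Complex.inv_I, neg_neg, Complex.cpow_def_of_ne_zero (by simp),
        Complex.log_I]
      congr 1; ring
    simp only [Pi.sub_apply, Complex.ofReal_zero, zero_add]
    rw [hI, hI', Complex.cos, neg_mul (Real.pi * (s + 1) / 2)]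
    field_simp
    ring
  · filter_upwards [self_mem_nhdsWithin] with ε hε
    rw [mellin_exp_neg_mul_sin h₁ h₂ hε]
    simp [sub_eq_add_neg]

lemma abs_sin_sub_mul_cos_le {x : ℝ} (hx : 0 ≤ x) : |Real.sin x - x * Real.cos x| ≤ x ^ 2 := by
  have hd : ∀ y : ℝ, HasDerivAt (fun y => Real.sin y - y * Real.cos y) (y * Real.sin y) y := by
    intro y
    refine ((Real.hasDerivAt_sin y).sub
      ((hasDerivAt_id y).mul (Real.hasDerivAt_cos y))).congr_deriv ?_
    simp
  have := norm_image_sub_le_of_norm_deriv_le_segment' (a := 0) (b := x) (C := x)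
    (fun y _ => (hd y).hasDerivWithinAt) (fun y hy => ?_) x ⟨hx, le_rfl⟩
  · simpa [sq] using this
  · rw [norm_mul, Real.norm_of_nonneg hy.1]
    exact (mul_le_of_le_one_right hy.1 (Real.abs_sin_le_one y)).trans hy.2.le

/-- The kernel `sin(2πt/v)/(πt)`. -/
noncomputable def sineKernel (t v : ℝ) : ℝ := Real.sin (2 * Real.pi * t / v) / (Real.pi * t)

lemma abs_sineKernel_le {t : ℝ} (ht : 0 < t) (v : ℝ) : |sineKernel t v| ≤ 1 / (Real.pi * t) := by
  have : 0 < Real.pi * t := by positivity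
  rw [sineKernel, abs_div, abs_of_pos this]
  gcongr
  exact Real.abs_sin_le_one _

lemma abs_sineKernel_le_div {t v : ℝ} (ht : 0 < t) (hv : 0 < v) : |sineKernel t v| ≤ 2 / v := by
  have : 0 < Real.pi * t := by positivity
  rw [sineKernel, abs_div, abs_of_pos this, div_le_iff₀ this]
  refine Real.abs_sin_le_abs.trans_eq ?_
  rw [abs_of_pos (by positivity)]
  ring

lemma continuousOn_sineKernel (t : ℝ) : ContinuousOn (sineKernel t) (Ioi 0) := by
  intro v hv
  have : v ≠ 0 := ne_of_gt hv
  unfold sineKernel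
  exact ContinuousAt.continuousWithinAt (by fun_prop (disch := assumption))

lemma continuousOn_cpow_mul_sineKernel (w : ℂ) (t : ℝ) :
    ContinuousOn (fun v : ℝ => (v : ℂ) ^ (-w) * (sineKernel t v : ℂ)) (Ioi 0) := by
  intro v hv
  exact ((Complex.continuousAt_ofReal_cpow_const v _ (Or.inr (ne_of_gt hv))).continuousWithinAt).mul
    (Complex.continuous_ofReal.continuousAt.comp_continuousWithinAt (continuousOn_sineKernel t v hv))

lemma hasDerivAt_mul_sin_div {t v : ℝ} (hv : v ≠ 0) :
    HasDerivAt (fun x : ℝ => x * Real.sin (2 * Real.pi * t / x) / (Real.pi * t))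
      ((Real.sin (2 * Real.pi * t / v) - 2 * Real.pi * t / v * Real.cos (2 * Real.pi * t / v))
        / (Real.pi * t)) v := by
  refine (((hasDerivAt_id v).mul (((hasDerivAt_inv hv).const_mul
    (2 * Real.pi * t)).sin)).div_const (Real.pi * t)).congr_deriv ?_
  simp only [id, ← div_eq_mul_inv]
  field_simp
  ring

lemma abs_deriv_mul_sin_div_le {t v : ℝ} (ht : 0 < t) (hv : 0 < v) :
    |deriv (fun x : ℝ => x * Real.sin (2 * Real.pi * t / x) / (Real.pi * t)) v|
      ≤ 4 * Real.pi * t * v ^ (-2 : ℤ) := by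
  have h : 0 < Real.pi * t := by positivity
  rw [(hasDerivAt_mul_sin_div hv.ne').deriv, abs_div, abs_of_pos h, div_le_iff₀ h]
  refine (abs_sin_sub_mul_cos_le (by positivity)).trans_eq ?_
  rw [zpow_neg]
  field_simp
  norm_num

lemma continuousOn_deriv_mul_sin_div (t : ℝ) :
    ContinuousOn (deriv (fun x : ℝ => x * Real.sin (2 * Real.pi * t / x) / (Real.pi * t)))
      (Ioi 0) := by
  refine ContinuousOn.congr (f := fun v => (Real.sin (2 * Real.pi * t / v)
    - 2 * Real.pi * t / v * Real.cos (2 * Real.pi * t / v)) / (Real.pi * t)) ?_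
    fun v hv => (hasDerivAt_mul_sin_div (ne_of_gt hv)).deriv
  intro v hv
  have : v ≠ 0 := ne_of_gt hv
  exact ContinuousAt.continuousWithinAt (by fun_prop (disch := assumption))

/-- Integration by parts on a compact interval of positive reals. -/
lemma integral_cpow_mul_deriv_eq {w : ℂ} (hw : w ≠ 1) {t p q : ℝ} (hp : 0 < p) (hq : 0 < q) :
    ∫ v in p..q, (v : ℂ) ^ (-w)
        * ((deriv (fun x : ℝ => x * Real.sin (2 * Real.pi * t / x) / (Real.pi * t)) v : ℝ) : ℂ) =
      (q : ℂ) ^ (1 - w) * sineKernel t q - (p : ℂ) ^ (1 - w) * sineKernel t p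
        + w * ∫ v in p..q, (v : ℂ) ^ (-w) * (sineKernel t v : ℂ) := by
  have hsub : uIcc p q ⊆ Ioi 0 := fun v hv => (lt_min hp hq).trans_le hv.1
  have i₁ : IntervalIntegrable (fun v : ℝ => (v : ℂ) ^ (-w) * (sineKernel t v : ℂ)) volume p q :=
    ((continuousOn_cpow_mul_sineKernel w t).mono hsub).intervalIntegrable
  have i₂ : IntervalIntegrable (fun v : ℝ => (v : ℂ) ^ (-w)
      * ((deriv (fun x : ℝ => x * Real.sin (2 * Real.pi * t / x) / (Real.pi * t)) v : ℝ) : ℂ))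
      volume p q := by
    refine ContinuousOn.intervalIntegrable fun v hv => ?_
    exact ((Complex.continuousAt_ofReal_cpow_const v _
      (Or.inr (ne_of_gt (hsub hv)))).continuousWithinAt).mul
      (Complex.continuous_ofReal.continuousAt.comp_continuousWithinAt
        ((continuousOn_deriv_mul_sin_div t).mono hsub v hv))
  rw [← sub_eq_iff_eq_add, ← intervalIntegral.integral_const_mul,
    ← intervalIntegral.integral_sub i₂ (i₁.const_mul w)]
  refine intervalIntegral.integral_eq_sub_of_hasDerivAt
    (f := fun v : ℝ => (v : ℂ) ^ (1 - w) * (sineKernel t v : ℂ)) (fun v hv => ?_)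
    (i₂.sub (i₁.const_mul w))
  have hv : 0 < v := hsub hv
  have hv' : (v : ℂ) ≠ 0 := by exact_mod_cast hv.ne'
  have h₁ := hasDerivAt_ofReal_cpow_const hv.ne' (sub_ne_zero.2 hw.symm)
  have h₂ : HasDerivAt (fun v : ℝ => (sineKernel t v : ℂ))
      ((-(2 * Real.pi * t / v ^ 2 * Real.cos (2 * Real.pi * t / v)) / (Real.pi * t) : ℝ) : ℂ) v := by
    refine HasDerivAt.ofReal_comp ?_
    refine ((((hasDerivAt_inv hv.ne').const_mul
      (2 * Real.pi * t)).sin).div_const (Real.pi * t)).congr_deriv ?_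
    simp only [← div_eq_mul_inv]
    ring
  refine (h₁.mul h₂).congr_deriv ?_
  rw [(hasDerivAt_mul_sin_div hv.ne').deriv, sub_right_comm, sub_self, zero_sub, sub_eq_add_neg 1 w,
    Complex.cpow_add _ _ hv', Complex.cpow_one]
  simp only [sineKernel]
  push_cast
  field_simp
  ring

lemma locallyIntegrableOn_sineKernel (t : ℝ) :
    LocallyIntegrableOn (fun v : ℝ => (sineKernel t v : ℂ)) (Ioi 0) :=
  (Complex.continuous_ofReal.comp_continuousOn (continuousOn_sineKernel t)).locallyIntegrableOn
    measurableSet_Ioi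

lemma sineKernel_isBigO_nhdsGT_zero {t : ℝ} (ht : 0 < t) :
    (fun v : ℝ => (sineKernel t v : ℂ)) =O[nhdsWithin 0 (Ioi 0)] (fun v : ℝ => v ^ (-0 : ℝ)) := by
  refine Asymptotics.IsBigO.of_bound (1 / (Real.pi * t)) (Eventually.of_forall fun v => ?_)
  simpa using abs_sineKernel_le ht v

lemma mellinConvergent_sineKernel {w : ℂ} (h₀ : 0 < w.re) (h₁ : w.re < 1) {t : ℝ} (ht : 0 < t) :
    MellinConvergent (fun v : ℝ => (sineKernel t v : ℂ)) (1 - w) := by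
  refine mellinConvergent_of_isBigO_rpow (a := 1) (b := 0) (locallyIntegrableOn_sineKernel t)
    ?_ (by simpa) (sineKernel_isBigO_nhdsGT_zero ht) (by simpa)
  refine Asymptotics.IsBigO.of_bound 2 ?_
  filter_upwards [eventually_gt_atTop 0] with v hv
  rw [Real.rpow_neg_one, norm_inv, Real.norm_of_nonneg hv.le, ← div_eq_mul_inv]
  simpa using abs_sineKernel_le_div ht hv

lemma mul_mellin_sineKernel {w : ℂ} (h₀ : 0 < w.re) (h₁ : w.re < 1) {t : ℝ} (ht : 0 < t) :
    w * mellin (fun v : ℝ => (sineKernel t v : ℂ)) (1 - w) = baezDuarteU w * (t : ℂ) ^ (-w) := by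
  have ha : 0 < 2 * Real.pi * t := by positivity
  have e : (fun v : ℝ => (sineKernel t v : ℂ)) = fun v : ℝ =>
      (fun x : ℝ => Complex.sin ((2 * Real.pi * t * x : ℝ) : ℂ)) v⁻¹ / ((Real.pi * t : ℝ) : ℂ) := by
    funext v
    simp [sineKernel, div_eq_mul_inv]
  rw [e, mellin_div_const, mellin_comp_inv (fun x : ℝ => Complex.sin ((2 * Real.pi * t * x : ℝ) : ℂ)),
    mellin_comp_mul_left (fun x : ℝ => Complex.sin x) _ ha,
    mellin_sin (by simpa using h₀) (by simpa using h₁), baezDuarteU, neg_neg]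
  have hw : 1 - w ≠ 0 := fun h => by
    rw [← sub_eq_zero.1 h] at h₁; simp at h₁
  have hw' : w - 1 ≠ 0 := fun h => hw (by rw [← neg_sub, h, neg_zero])
  have hpi : (Real.pi : ℂ) ≠ 0 := by exact_mod_cast Real.pi_ne_zero
  have ht' : (t : ℂ) ≠ 0 := by exact_mod_cast ht.ne'
  have h2 : ((2 * Real.pi * t : ℝ) : ℂ) ^ (1 - w) =
      (2 : ℂ) ^ (1 - w) * (Real.pi * (Real.pi : ℂ) ^ (-w)) * (t * (t : ℂ) ^ (-w)) := by
    rw [Complex.ofReal_mul, Complex.mul_cpow_ofReal_nonneg (by positivity) ht.le, Complex.ofReal_mul,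
      Complex.mul_cpow_ofReal_nonneg (by positivity) (by positivity), sub_eq_add_neg,
      Complex.cpow_add _ _ hpi, Complex.cpow_add _ _ ht', Complex.cpow_one, Complex.cpow_one]
    norm_num
  rw [h2, show -(1 - w) + 1 = w by ring]
  simp only [smul_eq_mul]
  push_cast
  field_simp

/-- The limit function: `sin(2πt)/(πt) + w ∫₀¹ v^{-w} sin(2πt/v)/(πt) dv`. -/
noncomputable def phiZero (w : ℂ) (t : ℝ) : ℂ :=
  sineKernel t 1 + w * ∫ v in Ioc (0 : ℝ) 1, (v : ℂ) ^ (-w) * (sineKernel t v : ℂ)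

lemma norm_cpow_mul_sineKernel_le {w : ℂ} {t v : ℝ} (ht : 0 < t) (hv : 0 < v) :
    ‖(v : ℂ) ^ (-w) * (sineKernel t v : ℂ)‖ ≤ v ^ (-w.re) * (1 / (Real.pi * t)) := by
  rw [norm_mul, Complex.norm_cpow_eq_rpow_re_of_pos hv, Complex.norm_real, Complex.neg_re]
  gcongr
  exact abs_sineKernel_le ht v

lemma integrableOn_rpow_neg_Ioc {a : ℝ} (ha : a < 1) :
    IntegrableOn (fun v : ℝ => v ^ (-a)) (Ioc 0 1) :=
  (intervalIntegrable_iff_integrableOn_Ioc_of_le zero_le_one).1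
    (intervalIntegral.intervalIntegrable_rpow' (by linarith))

lemma integrableOn_cpow_mul_sineKernel {w : ℂ} (hw : w.re < 1) {t : ℝ} (ht : 0 < t) :
    IntegrableOn (fun v : ℝ => (v : ℂ) ^ (-w) * (sineKernel t v : ℂ)) (Ioc 0 1) := by
  refine ((integrableOn_rpow_neg_Ioc hw).mul_const (1 / (Real.pi * t))).mono' ?_ ?_
  · exact ((continuousOn_cpow_mul_sineKernel w t).mono
      fun v hv => hv.1).aestronglyMeasurable measurableSet_Ioc
  · exact (ae_restrict_iff' measurableSet_Ioc).2
      (Eventually.of_forall fun v hv => norm_cpow_mul_sineKernel_le ht hv.1)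

lemma norm_phiZero_le {w : ℂ} (hw : w.re < 1) {t : ℝ} (ht : 0 < t) :
    ‖phiZero w t‖ ≤ (1 + ‖w‖ / (1 - w.re)) / (Real.pi * t) := by
  have hint : ‖∫ v in Ioc (0 : ℝ) 1, (v : ℂ) ^ (-w) * (sineKernel t v : ℂ)‖
      ≤ 1 / (1 - w.re) * (1 / (Real.pi * t)) := by
    refine (MeasureTheory.norm_integral_le_of_norm_le
      ((integrableOn_rpow_neg_Ioc hw).mul_const (1 / (Real.pi * t)))
      ((ae_restrict_iff' measurableSet_Ioc).2
        (Eventually.of_forall fun v hv => norm_cpow_mul_sineKernel_le ht hv.1))).trans_eq ?_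
    rw [MeasureTheory.integral_mul_const, ← intervalIntegral.integral_of_le zero_le_one,
      integral_rpow (Or.inl (by linarith)), Real.one_rpow, Real.zero_rpow (by linarith)]
    ring
  calc ‖phiZero w t‖ ≤ 1 / (Real.pi * t) + ‖w‖ * (1 / (1 - w.re) * (1 / (Real.pi * t))) := by
        refine (norm_add_le _ _).trans (add_le_add ?_ ?_)
        · simpa using abs_sineKernel_le ht 1
        · rw [norm_mul]
          gcongr
    _ = _ := by ring

lemma tendsto_phiZero {w : ℂ} (hw : w.re < 1) {t : ℝ} (ht : 0 < t) :
    Tendsto (fun δ : ℝ => ∫ v in δ..1, (v : ℂ) ^ (-w)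
        * ((deriv (fun x : ℝ => x * Real.sin (2 * Real.pi * t / x) / (Real.pi * t)) v : ℝ) : ℂ))
      (nhdsWithin 0 (Ioi 0)) (nhds (phiZero w t)) := by
  have hw1 : w ≠ 1 := fun h => by simp [h] at hw
  have hbd : Tendsto (fun δ : ℝ => (δ : ℂ) ^ (1 - w) * (sineKernel t δ : ℂ))
      (nhdsWithin 0 (Ioi 0)) (nhds 0) := by
    have h : Tendsto (fun δ : ℝ => δ ^ (1 - w.re) * (1 / (Real.pi * t))) (nhdsWithin 0 (Ioi 0))
        (nhds 0) := by
      have := (Real.continuousAt_rpow_const 0 (1 - w.re) (Or.inr (by linarith))).tendsto.mul_const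
        (1 / (Real.pi * t))
      rw [Real.zero_rpow (by linarith), zero_mul] at this
      exact this.mono_left nhdsWithin_le_nhds
    refine squeeze_zero_norm' ?_ h
    filter_upwards [self_mem_nhdsWithin] with δ hδ
    simpa using norm_cpow_mul_sineKernel_le (w := w - 1) ht hδ
  have hint : Tendsto (fun δ : ℝ => ∫ v in δ..1, (v : ℂ) ^ (-w) * (sineKernel t v : ℂ))
      (nhdsWithin 0 (Ioi 0)) (nhds (∫ v in Ioc (0 : ℝ) 1, (v : ℂ) ^ (-w) * (sineKernel t v : ℂ))) := by
    have hi := integrableOn_cpow_mul_sineKernel hw ht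
    rw [← integrableOn_Icc_iff_integrableOn_Ioc, ← uIcc_of_le zero_le_one] at hi
    have hc := intervalIntegral.continuousOn_primitive_interval_left hi 0 left_mem_uIcc
    rw [← intervalIntegral.integral_of_le zero_le_one]
    refine hc.mono_left ?_
    rw [uIcc_of_le zero_le_one, nhdsWithin_Icc_eq_nhdsGE one_pos]
    exact nhdsWithin_mono _ Ioi_subset_Ici_self
  have := ((hbd.const_sub (sineKernel t 1 : ℂ)).add (hint.const_mul w))
  rw [sub_zero] at this
  refine this.congr' ?_
  filter_upwards [self_mem_nhdsWithin] with δ hδ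
  rw [integral_cpow_mul_deriv_eq hw1 hδ one_pos]
  simp

lemma differentiableOn_phiZero {t : ℝ} (ht : 0 < t) :
    DifferentiableOn ℂ (fun w => phiZero w t) {w : ℂ | w.re < 1} := by
  intro w hw
  have hw : w.re < 1 := hw
  set g : ℝ → ℂ := (Iic (1 : ℝ)).indicator fun v => (sineKernel t v : ℂ) with hg
  have heq : (fun w => phiZero w t) = fun w => (sineKernel t 1 : ℂ) + w * mellin g (1 - w) := by
    funext z
    rw [phiZero, mellin]
    congr 2
    have : ∀ v : ℝ, (v : ℂ) ^ (1 - z - 1) • g v =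
        (Iic (1 : ℝ)).indicator (fun v => (v : ℂ) ^ (-z) * (sineKernel t v : ℂ)) v := fun v => by
      rw [sub_right_comm, sub_self, zero_sub, hg, smul_eq_mul]
      by_cases h : v ∈ Iic (1 : ℝ) <;> simp [h]
    simp_rw [this]
    rw [setIntegral_indicator measurableSet_Iic, Ioi_inter_Iic]
  have hnorm : ∀ v, ‖g v‖ ≤ ‖(sineKernel t v : ℂ)‖ := fun v => norm_indicator_le_norm_self _ _
  have hmel : DifferentiableAt ℂ (mellin g) (1 - w) := by
    refine mellin_differentiableAt_of_isBigO_rpow (a := (1 - w).re + 1) (b := 0) ?_ ?_ (by linarith)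
      ((Asymptotics.isBigO_of_le _ hnorm).trans (sineKernel_isBigO_nhdsGT_zero ht)) (by simpa)
    · intro x hx
      obtain ⟨u, hu, hi⟩ := locallyIntegrableOn_sineKernel t x hx
      exact ⟨u, hu, hi.indicator measurableSet_Iic⟩
    · refine Asymptotics.IsBigO.of_bound 0 ?_
      filter_upwards [eventually_gt_atTop 1] with v hv
      simp [hg, hv]
  rw [heq]
  refine DifferentiableAt.differentiableWithinAt ?_
  exact (differentiableAt_const _).add (differentiableAt_id.mul
    (hmel.comp w ((differentiableAt_const 1).sub differentiableAt_id)))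

lemma norm_phiZero_sub_le {w : ℂ} (h₀ : 0 < w.re) (h₁ : w.re < 1) {t : ℝ} (ht : 0 < t) :
    ‖phiZero w t - baezDuarteU w * (t : ℂ) ^ (-w)‖ ≤ 4 * Real.pi * t := by
  have hw1 : w ≠ 1 := fun h => by simp [h] at h₁
  have hconv : IntegrableOn (fun v : ℝ => (v : ℂ) ^ (-w) * (sineKernel t v : ℂ)) (Ioi 0) := by
    simpa [MellinConvergent] using mellinConvergent_sineKernel h₀ h₁ ht
  have hU : baezDuarteU w * (t : ℂ) ^ (-w) =
      w * ∫ v in Ioi (0 : ℝ), (v : ℂ) ^ (-w) * (sineKernel t v : ℂ) := by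
    rw [← mul_mellin_sineKernel h₀ h₁ ht]
    simp [mellin]
  have hsplit := setIntegral_union (Ioc_disjoint_Ioi_same (a := (0 : ℝ)) (b := 1)) measurableSet_Ioi
    (hconv.mono_set Ioc_subset_Ioi_self) (hconv.mono_set (Ioi_subset_Ioi zero_le_one))
  rw [Ioc_union_Ioi_eq_Ioi zero_le_one] at hsplit
  have hval : phiZero w t - baezDuarteU w * (t : ℂ) ^ (-w) = sineKernel t 1
      - w * ∫ v in Ioi (1 : ℝ), (v : ℂ) ^ (-w) * (sineKernel t v : ℂ) := by
    rw [hU, hsplit, phiZero]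
    ring
  have hbd : Tendsto (fun V : ℝ => (V : ℂ) ^ (1 - w) * (sineKernel t V : ℂ)) atTop (nhds 0) := by
    have h := (tendsto_rpow_neg_atTop h₀).mul_const 2
    rw [zero_mul] at h
    refine squeeze_zero_norm' ?_ h
    filter_upwards [eventually_gt_atTop 0] with V hV
    rw [norm_mul, Complex.norm_cpow_eq_rpow_re_of_pos hV, Complex.norm_real, Complex.sub_re,
      Complex.one_re, sub_eq_neg_add, Real.rpow_add_one hV.ne', mul_assoc]
    gcongr
    rw [mul_comm, ← le_div_iff₀ hV]
    exact abs_sineKernel_le_div ht hV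
  have hlim : Tendsto (fun V : ℝ => ‖(V : ℂ) ^ (1 - w) * sineKernel t V - sineKernel t 1
      + w * ∫ v in (1 : ℝ)..V, (v : ℂ) ^ (-w) * (sineKernel t v : ℂ)‖) atTop
      (nhds ‖phiZero w t - baezDuarteU w * (t : ℂ) ^ (-w)‖) := by
    rw [hval, ← norm_neg, neg_sub', sub_neg_eq_add, ← zero_sub (sineKernel t 1 : ℂ)]
    exact ((hbd.sub_const (sineKernel t 1 : ℂ)).add
      ((intervalIntegral_tendsto_integral_Ioi 1 (hconv.mono_set (Ioi_subset_Ioi zero_le_one))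
        tendsto_id).const_mul w)).norm
  refine le_of_tendsto hlim ?_
  filter_upwards [eventually_ge_atTop 1] with V hV
  have hibp := integral_cpow_mul_deriv_eq hw1 (t := t) one_pos (one_pos.trans_le hV)
  rw [Complex.ofReal_one, Complex.one_cpow, one_mul] at hibp
  rw [← hibp]
  have hmem : (0 : ℝ) ∉ uIcc 1 V := by
    rw [uIcc_of_le hV]; exact fun h => absurd h.1 (by norm_num)
  refine (intervalIntegral.norm_integral_le_of_norm_le (g := fun v => 4 * Real.pi * t * v ^ (-2 : ℤ))
    hV (Eventually.of_forall fun v hv => ?_) ?_).trans ?_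
  · have hv0 : 0 < v := one_pos.trans hv.1
    rw [norm_mul, Complex.norm_cpow_eq_rpow_re_of_pos hv0, Complex.norm_real]
    refine (mul_le_of_le_one_left (norm_nonneg _) ?_).trans (abs_deriv_mul_sin_div_le ht hv0)
    exact Real.rpow_le_one_of_one_le_of_nonpos hv.1.le (by simpa using h₀.le)
  · exact (intervalIntegral.intervalIntegrable_zpow (Or.inr hmem)).const_mul _
  · rw [intervalIntegral.integral_const_mul, integral_zpow (Or.inr ⟨by norm_num, hmem⟩)]
    refine mul_le_of_le_one_right (by positivity) ?_
    have : 0 ≤ V⁻¹ := by positivity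
    norm_num
    linarith

/-- Properties of `φ_{w,0}(t) = lim_{δ→0⁺} ∫_δ^1 v^{-w}·(d/dv)[v·sin(2πt/v)/(πt)] dv`:
existence of the limit for `Re w < 1`, `t > 0`; holomorphy in `w`; the uniform `O(1/t)`
bound on `[1,∞)` for `w` in compact subsets of `{Re w < 1}`; and
`φ_{w,0}(t) = U(w)·t^{-w} + O(1)` on `(0,1]` uniformly for `0 < Re w < 1`. -/
theorem phi_zero_exists_holomorphic_and_bounds :
    ∃ φ : ℂ → ℝ → ℂ,
      (∀ w : ℂ, w.re < 1 → ∀ t : ℝ, 0 < t →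
        Filter.Tendsto
          (fun δ : ℝ => ∫ v in δ..1,
            (v : ℂ) ^ (-w)
              * ((deriv (fun x : ℝ => x * Real.sin (2 * Real.pi * t / x) / (Real.pi * t)) v : ℝ) : ℂ))
          (nhdsWithin 0 (Set.Ioi 0)) (nhds (φ w t))) ∧
      (∀ t : ℝ, 0 < t → DifferentiableOn ℂ (fun w => φ w t) {w : ℂ | w.re < 1}) ∧
      (∀ Ω : Set ℂ, IsCompact Ω → Ω ⊆ {w : ℂ | w.re < 1} →
        ∃ C : ℝ, ∀ w ∈ Ω, ∀ t : ℝ, 1 ≤ t → ‖φ w t‖ ≤ C / t) ∧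
      (∃ C' : ℝ, ∀ w : ℂ, 0 < w.re → w.re < 1 → ∀ t : ℝ, 0 < t → t ≤ 1 →
        ‖φ w t - baezDuarteU w * (t : ℂ) ^ (-w)‖ ≤ C') := by
  refine ⟨phiZero, fun w hw t ht => tendsto_phiZero hw ht, fun t ht => differentiableOn_phiZero ht,
    fun Ω hΩ hsub => ?_, 4 * Real.pi, fun w h₀ h₁ t ht ht1 => ?_⟩
  · have hcont : ContinuousOn (fun w : ℂ => (1 + ‖w‖ / (1 - w.re)) / Real.pi) Ω := by
      intro w hw
      have : 1 - w.re ≠ 0 := (sub_pos.2 (hsub hw)).ne'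
      exact ((continuousAt_const.add (continuous_norm.continuousAt.div
        (continuousAt_const.sub Complex.continuous_re.continuousAt) this)).div_const
          Real.pi).continuousWithinAt
    obtain ⟨C, hC⟩ := hΩ.exists_bound_of_continuousOn hcont
    refine ⟨C, fun w hw t ht => ?_⟩
    have ht0 : 0 < t := one_pos.trans_le ht
    refine (norm_phiZero_le (hsub hw) ht0).trans ?_
    rw [← div_div]
    gcongr
    exact (le_abs_self _).trans (hC w hw)
  · refine (norm_phiZero_sub_le h₀ h₁ ht).trans ?_
    exact mul_le_of_le_one_right (by positivity) ht1
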